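/- For the fuzzy sets u, v of the Example on I = [0,1], the Skorokhod distance satisfies d_0(u, v) = 1/4. -/

import Mathlib

open Set Metric Filter
open scoped Classical

noncomputable section

/-- The `α`-cut `[u]_α = {x | u x ≥ α}` of a fuzzy set for `α ∈ (0,1]`,
and its support `[u]_0 = closure {x | u x > 0}` for `α = 0`. -/
def fcut {X : Type*} [TopologicalSpace X] (u : X → ℝ) (α : ℝ) : Set X :=
  if α = 0 then closure {x | 0 < u x} else {x | α ≤ u x}

/-- `u ∈ 𝔉(X)`: an upper semicontinuous fuzzy set (with values in `[0,1]`)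
whose support is compact and whose `1`-cut is nonempty. -/
def IsFuzzy {X : Type*} [TopologicalSpace X] (u : X → ℝ) : Prop :=
  UpperSemicontinuous u ∧ (∀ x, u x ∈ Icc (0 : ℝ) 1) ∧
    IsCompact (fcut u 0) ∧ (fcut u 1).Nonempty

/-- The level-wise metric `d_∞(u,v) = sup{d_H([u]_α, [v]_α) : α ∈ [0,1]}`. -/
def dInfty {X : Type*} [MetricSpace X] (u v : X → ℝ) : ℝ :=
  ⨆ α : Icc (0 : ℝ) 1, hausdorffDist (fcut u α.1) (fcut v α.1)

/-- `t ∈ Hom(I)`: a strictly increasing homeomorphism of `I = [0,1]` onto itself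
(recorded as a map `ℝ → ℝ`, considered on `[0,1]`). -/
def IsHomI (t : ℝ → ℝ) : Prop :=
  StrictMonoOn t (Icc 0 1) ∧ ContinuousOn t (Icc 0 1) ∧
    MapsTo t (Icc 0 1) (Icc 0 1) ∧ SurjOn t (Icc 0 1) (Icc 0 1)

/-- The Skorokhod metric
`d_0(u,v) = inf{ε > 0 : ∃ t ∈ Hom(I), sup_{x ∈ I} |t x - x| ≤ ε and d_∞(u, t∘v) ≤ ε}`. -/
def dSk {X : Type*} [MetricSpace X] (u v : X → ℝ) : ℝ :=
  sInf {ε : ℝ | 0 < ε ∧ ∃ t : ℝ → ℝ, IsHomI t ∧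
    (∀ x ∈ Icc (0 : ℝ) 1, |t x - x| ≤ ε) ∧ dInfty u (t ∘ v) ≤ ε}

/-- Zadeh's extension of `f`: `f̃(u)(x) = sup{u z : z ∈ f⁻¹(x)}`, which is `0`
when `f⁻¹(x) = ∅` since `sSup ∅ = 0` in `ℝ`. -/
def zadeh {X : Type*} (f : X → X) (u : X → ℝ) : X → ℝ :=
  fun x => sSup (u '' (f ⁻¹' {x}))

/-- The unit interval `I = [0,1]` as a metric space. -/
abbrev I01 : Type := Set.Icc (0 : ℝ) 1

/-- `a_n = 1 - (5/8)/2^n` (so `a_0 = 3/8`). -/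
def aSeq (n : ℕ) : ℝ := 1 - 5 / 8 / 2 ^ n

/-- `a'_0 = 3/8` and `a'_n = 1 - (1/4)/2^n` for `n ≥ 1` (so `a'_1 = 7/8`). -/
def aSeq' (n : ℕ) : ℝ := if n = 0 then 3 / 8 else 1 - 1 / 4 / 2 ^ n

/-- `b'_0 = 1/8` and `b'_n = a'_n` for `n ≥ 1`. -/
def bSeq' (n : ℕ) : ℝ := if n = 0 then 1 / 8 else aSeq' n

/-- `u(x) = 0` on `[0, 3/8)`, `u(x) = a_n` on `[a'_n, a'_{n+1})`, and `u(1) = 1`. -/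
def uAux (x : ℝ) : ℝ :=
  if x = 1 then 1
  else if h : ∃ n : ℕ, aSeq' n ≤ x ∧ x < aSeq' (n + 1) then aSeq h.choose
  else 0

/-- `v(x) = 0` on `[0, 1/8)`, `v(x) = 1/8` on `[1/8, 7/8)`, `v(x) = 5/8` on `[7/8, 15/16)`,
`v(x) = a_{n-1}` on `[b'_n, b'_{n+1})` for `n ≥ 2`, and `v(1) = 1`. -/
def vAux (x : ℝ) : ℝ :=
  if x = 1 then 1
  else if x < 1 / 8 then 0
  else if x < 7 / 8 then 1 / 8
  else if x < 15 / 16 then 5 / 8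
  else if h : ∃ n : ℕ, 2 ≤ n ∧ bSeq' n ≤ x ∧ x < bSeq' (n + 1) then aSeq (h.choose - 1)
  else 0

/-- The fuzzy set `u` of the Example, as a function on `I = [0,1]`. -/
def uEx : I01 → ℝ := fun x => uAux x.1

/-- The fuzzy set `v` of the Example, as a function on `I = [0,1]`. -/
def vEx : I01 → ℝ := fun x => vAux x.1

theorem uAux_one : uAux 1 = 1 := by simp [uAux]

theorem vAux_one : vAux 1 = 1 := by simp [vAux]

theorem three_eighths_le_aSeq' (n : ℕ) : 3 / 8 ≤ aSeq' n := by
  unfold aSeq'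
  split_ifs with h
  · exact le_rfl
  · have : (1 : ℝ) / 4 / 2 ^ n ≤ 1 / 4 := div_le_self (by norm_num) (one_le_pow₀ (by norm_num))
    linarith

theorem seven_eighths_le_aSeq' {n : ℕ} (hn : n ≠ 0) : 7 / 8 ≤ aSeq' n := by
  have h2 : (2 : ℝ) ≤ 2 ^ n := le_self_pow₀ (by norm_num) hn
  have : (1 : ℝ) / 4 / 2 ^ n ≤ 1 / 4 / 2 := by gcongr
  rw [aSeq', if_neg hn]
  linarith

theorem uAux_eq_zero {x : ℝ} (hx : x < 3 / 8) : uAux x = 0 := by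
  have h : ¬ ∃ n : ℕ, aSeq' n ≤ x ∧ x < aSeq' (n + 1) := by
    rintro ⟨n, hn, -⟩
    linarith [three_eighths_le_aSeq' n]
  rw [uAux, if_neg (by linarith), dif_neg h]

theorem uAux_eq_three_eighths {x : ℝ} (hx : 3 / 8 ≤ x) (hx' : x < 7 / 8) : uAux x = 3 / 8 := by
  have h : ∃ n : ℕ, aSeq' n ≤ x ∧ x < aSeq' (n + 1) :=
    ⟨0, by simpa [aSeq'] using hx, hx'.trans_le (seven_eighths_le_aSeq' (by norm_num))⟩
  have h0 : h.choose = 0 := by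
    by_contra hne
    linarith [h.choose_spec.1, seven_eighths_le_aSeq' hne]
  rw [uAux, if_neg (by linarith), dif_pos h, h0]
  norm_num [aSeq]

theorem vAux_eq_zero {x : ℝ} (hx : x < 1 / 8) : vAux x = 0 := by
  rw [vAux, if_neg (by linarith), if_pos hx]

theorem vAux_eq_one_eighth {x : ℝ} (hx : 1 / 8 ≤ x) (hx' : x < 7 / 8) : vAux x = 1 / 8 := by
  rw [vAux, if_neg (by linarith), if_neg (by linarith), if_pos hx']

namespace IsHomI

variable {t : ℝ → ℝ}

theorem map_zero (ht : IsHomI t) : t 0 = 0 := by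
  obtain ⟨hmono, -, hmaps, hsurj⟩ := ht
  obtain ⟨y, hy, hty⟩ := hsurj (left_mem_Icc.2 zero_le_one)
  have h0 : (0 : ℝ) ∈ Icc (0 : ℝ) 1 := left_mem_Icc.2 zero_le_one
  exact le_antisymm ((hmono.monotoneOn h0 hy hy.1).trans hty.le) (hmaps h0).1

theorem map_one (ht : IsHomI t) : t 1 = 1 := by
  obtain ⟨hmono, -, hmaps, hsurj⟩ := ht
  obtain ⟨y, hy, hty⟩ := hsurj (right_mem_Icc.2 zero_le_one)
  have h1 : (1 : ℝ) ∈ Icc (0 : ℝ) 1 := right_mem_Icc.2 zero_le_one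
  exact le_antisymm (hmaps h1).2 (hty.ge.trans (hmono.monotoneOn hy h1 hy.2))

end IsHomI

theorem I01.dist_le_one (x y : I01) : dist x y ≤ 1 := by
  have hx := x.2
  have hy := y.2
  rw [Subtype.dist_eq, Real.dist_eq, abs_le]
  constructor <;> linarith [hx.1, hx.2, hy.1, hy.2]

theorem I01.dist_one_le_quarter {x : I01} (hx : 7 / 8 ≤ x.1) : dist x 1 ≤ 1 / 4 := by
  rw [Subtype.dist_eq, Real.dist_eq, abs_le]
  change -(1 / 4) ≤ x.1 - 1 ∧ x.1 - 1 ≤ 1 / 4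
  constructor <;> linarith [x.2.2]

theorem mem_fcut_of_eq_one {X : Type*} [TopologicalSpace X] {w : X → ℝ} {x : X} (h : w x = 1)
    {α : ℝ} (hα : α ≤ 1) : x ∈ fcut w α := by
  unfold fcut
  split_ifs
  · exact subset_closure (by simp [h])
  · simpa [h] using hα

theorem hausdorffDist_fcut_le_one {w w' : I01 → ℝ} (hw : w 1 = 1) (hw' : w' 1 = 1)
    {α : ℝ} (hα : α ≤ 1) : hausdorffDist (fcut w α) (fcut w' α) ≤ 1 :=
  hausdorffDist_le_of_mem_dist zero_le_one
    (fun x _ => ⟨1, mem_fcut_of_eq_one hw' hα, I01.dist_le_one x 1⟩)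
    (fun x _ => ⟨1, mem_fcut_of_eq_one hw hα, I01.dist_le_one x 1⟩)

theorem hausdorffDist_support_le_dInfty {w w' : I01 → ℝ} (hw : w 1 = 1) (hw' : w' 1 = 1) :
    hausdorffDist {x | 0 < w x} {x | 0 < w' x} ≤ dInfty w w' := by
  have hb : BddAbove (range fun α : Icc (0 : ℝ) 1 =>
      hausdorffDist (fcut w α.1) (fcut w' α.1)) := by
    refine ⟨1, ?_⟩
    rintro _ ⟨α, rfl⟩
    exact hausdorffDist_fcut_le_one hw hw' α.2.2
  have h := le_ciSup hb ⟨0, left_mem_Icc.2 zero_le_one⟩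
  simpa [fcut, dInfty] using h

theorem quarter_le_dInfty {t : ℝ → ℝ} (ht : IsHomI t) : 1 / 4 ≤ dInfty uEx (t ∘ vEx) := by
  have hu : uEx 1 = 1 := uAux_one
  have hv : (t ∘ vEx) 1 = 1 := by
    change t (vAux 1) = 1
    rw [vAux_one, ht.map_one]
  refine le_trans ?_ (hausdorffDist_support_le_dInfty hu hv)
  have hmem : (⟨1 / 8, by norm_num⟩ : I01) ∈ {x | 0 < (t ∘ vEx) x} := by
    change 0 < t (vAux (1 / 8))
    rw [vAux_eq_one_eighth le_rfl (by norm_num), ← ht.map_zero]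
    exact ht.1 (by norm_num) (by norm_num) (by norm_num)
  have hne : {x | 0 < uEx x}.Nonempty := ⟨1, by simp [hu]⟩
  have hfin : hausdorffEDist {x | 0 < (t ∘ vEx) x} {x | 0 < uEx x} ≠ ⊤ :=
    hausdorffEDist_ne_top_of_nonempty_of_bounded ⟨_, hmem⟩ hne
      (Bornology.IsBounded.all _) (Bornology.IsBounded.all _)
  rw [hausdorffDist_comm]
  refine le_trans ?_ (infDist_le_hausdorffDist_of_mem hmem hfin)
  refine (le_infDist hne).2 fun {y} hy => ?_
  have hy' : 3 / 8 ≤ y.1 := by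
    by_contra! h
    have : uEx y = 0 := uAux_eq_zero h
    simp [this] at hy
  rw [Subtype.dist_eq, Real.dist_eq, abs_sub_comm]
  refine le_trans ?_ (le_abs_self _)
  change 1 / 4 ≤ y.1 - 1 / 8
  linarith

theorem hausdorffDist_le_quarter {S T : Set I01} (hS1 : 1 ∈ S) (hT1 : 1 ∈ T)
    (hS : ∀ x ∈ S, 3 / 8 ≤ x.1) (hT : ∀ x ∈ T, 1 / 8 ≤ x.1)
    (hS' : ∀ x : I01, 3 / 8 ≤ x.1 → x.1 < 7 / 8 → x ∈ S)
    (hT' : ∀ x : I01, 1 / 8 ≤ x.1 → x.1 < 7 / 8 → x ∈ T) :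
    hausdorffDist S T ≤ 1 / 4 := by
  refine hausdorffDist_le_of_mem_dist (by norm_num) (fun x hx => ?_) (fun x hx => ?_)
  · rcases lt_or_ge x.1 (7 / 8) with h | h
    · exact ⟨x, hT' x (by linarith [hS x hx]) h, by simp⟩
    · exact ⟨1, hT1, I01.dist_one_le_quarter h⟩
  · rcases lt_or_ge x.1 (7 / 8) with h | h
    · rcases lt_or_ge x.1 (3 / 8) with h' | h'
      · refine ⟨⟨3 / 8, by norm_num⟩, hS' _ le_rfl (by norm_num), ?_⟩
        rw [Subtype.dist_eq, Real.dist_eq, abs_le]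
        constructor <;> linarith [hT x hx]
      · exact ⟨x, hS' x h' h, by simp⟩
    · exact ⟨1, hS1, I01.dist_one_le_quarter h⟩

theorem hausdorffDist_le_quarter_of_ge {S T : Set I01} (hS1 : 1 ∈ S) (hT1 : 1 ∈ T)
    (hS : ∀ x ∈ S, 7 / 8 ≤ x.1) (hT : ∀ x ∈ T, 7 / 8 ≤ x.1) :
    hausdorffDist S T ≤ 1 / 4 := by
  exact hausdorffDist_le_of_mem_dist (by norm_num)
    (fun x hx => ⟨1, hT1, I01.dist_one_le_quarter (hS x hx)⟩) (fun x hx => ⟨1, hS1, I01.dist_one_le_quarter (hT x hx)⟩)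

/-- The piecewise linear homeomorphism of `[0,1]` with a single break point, sending
`1/8` to `3/8`. -/
def breakHom (x : ℝ) : ℝ := min (3 * x) (3 / 8 + 5 / 7 * (x - 1 / 8))

theorem breakHom_strictMono : StrictMono breakHom :=
  fun x y h => min_lt_min (by linarith) (by linarith)

theorem breakHom_zero : breakHom 0 = 0 := by norm_num [breakHom]

theorem breakHom_one : breakHom 1 = 1 := by norm_num [breakHom]

theorem breakHom_one_eighth : breakHom (1 / 8) = 3 / 8 := by norm_num [breakHom]

theorem continuous_breakHom : Continuous breakHom := by
  unfold breakHom
  fun_prop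

theorem isHomI_breakHom : IsHomI breakHom := by
  refine ⟨breakHom_strictMono.strictMonoOn _, continuous_breakHom.continuousOn, fun x hx => ?_, ?_⟩
  · rw [← breakHom_zero, ← breakHom_one]
    exact ⟨breakHom_strictMono.monotone (by simpa [breakHom_zero] using hx.1),
      breakHom_strictMono.monotone (by simpa [breakHom_one] using hx.2)⟩
  · have := intermediate_value_Icc (zero_le_one' ℝ) continuous_breakHom.continuousOn
    rwa [breakHom_zero, breakHom_one] at this

theorem abs_breakHom_sub_le {x : ℝ} (hx : x ∈ Icc (0 : ℝ) 1) : |breakHom x - x| ≤ 1 / 4 := by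
  obtain ⟨h0, h1⟩ := hx
  unfold breakHom
  rw [abs_le]
  rcases min_cases (3 * x) (3 / 8 + 5 / 7 * (x - 1 / 8)) with ⟨h, h'⟩ | ⟨h, h'⟩ <;> rw [h] <;>
    constructor <;> linarith

theorem dInfty_breakHom_le : dInfty uEx (breakHom ∘ vEx) ≤ 1 / 4 := by
  have hu1 : uEx 1 = 1 := uAux_one
  have hv1 : (breakHom ∘ vEx) 1 = 1 := by
    change breakHom (vAux 1) = 1
    rw [vAux_one, breakHom_one]
  have hu0 : ∀ x : I01, x.1 < 3 / 8 → uEx x = 0 := fun x => uAux_eq_zero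
  have hu : ∀ x : I01, 3 / 8 ≤ x.1 → x.1 < 7 / 8 → uEx x = 3 / 8 :=
    fun x => uAux_eq_three_eighths
  have hv0 : ∀ x : I01, x.1 < 1 / 8 → (breakHom ∘ vEx) x = 0 := fun x h => by
    change breakHom (vAux x.1) = 0
    rw [vAux_eq_zero h, breakHom_zero]
  have hv : ∀ x : I01, 1 / 8 ≤ x.1 → x.1 < 7 / 8 → (breakHom ∘ vEx) x = 3 / 8 := fun x h h' => by
    change breakHom (vAux x.1) = 3 / 8
    rw [vAux_eq_one_eighth h h', breakHom_one_eighth]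
  have : Nonempty (Icc (0 : ℝ) 1) := ⟨⟨0, by norm_num⟩⟩
  refine ciSup_le fun ⟨α, hα⟩ => ?_
  dsimp only
  generalize breakHom ∘ vEx = w at *
  by_cases h0 : α = 0
  · subst h0
    simp only [fcut, if_true, hausdorffDist_closure]
    refine hausdorffDist_le_quarter (by simp [hu1]) (by simp [hv1]) ?_ ?_ ?_ ?_
    · intro x hx
      by_contra! h
      simp [hu0 x h] at hx
    · intro x hx
      by_contra! h
      simp [hv0 x h] at hx
    · intro x h h'
      simp [hu x h h']
    · intro x h h'
      simp [hv x h h']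
  have hpos : 0 < α := lt_of_le_of_ne hα.1 (Ne.symm h0)
  have h1 := mem_fcut_of_eq_one hu1 hα.2
  have h2 := mem_fcut_of_eq_one hv1 hα.2
  simp only [fcut, if_neg h0] at h1 h2 ⊢
  rcases le_or_gt α (3 / 8) with hα' | hα'
  · refine hausdorffDist_le_quarter h1 h2 ?_ ?_ ?_ ?_
    · intro x (hx : α ≤ uEx x)
      by_contra! h
      linarith [hu0 x h]
    · intro x (hx : α ≤ w x)
      by_contra! h
      linarith [hv0 x h]
    · intro x h h'
      exact hα'.trans (hu x h h').ge
    · intro x h h'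
      exact hα'.trans (hv x h h').ge
  · refine hausdorffDist_le_quarter_of_ge h1 h2 ?_ ?_
    · intro x (hx : α ≤ uEx x)
      by_contra! h
      rcases lt_or_ge x.1 (3 / 8) with h' | h'
      · linarith [hu0 x h']
      · linarith [hu x h' h]
    · intro x (hx : α ≤ w x)
      by_contra! h
      rcases lt_or_ge x.1 (1 / 8) with h' | h'
      · linarith [hv0 x h']
      · have := hv x h' h
        linarith

/-- For the fuzzy sets `u`, `v` of the Example, the Skorokhod distance is
`d_0(u, v) = 1/4`. -/
theorem statement10 : dSk uEx vEx = 1 / 4 := by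
  refine IsLeast.csInf_eq ⟨⟨by norm_num, breakHom, isHomI_breakHom,
    fun x hx => abs_breakHom_sub_le hx, dInfty_breakHom_le⟩, ?_⟩
  rintro ε ⟨-, t, ht, -, hε⟩
  exact (quarter_le_dInfty ht).trans hε
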